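/- Let n ∈ ℕ and let I ⊆ ℝ be an interval. If f : I → ℝ is n-concave, g : I → ℝ is n-convex, and f(x) ≤ g(x) for all x ∈ I, then there exists a polynomial w of degree at most n such that f(x) ≤ w(x) ≤ g(x) for all x ∈ I. -/

import Mathlib

/-- Lagrange basis coefficient: `lagC t z i = ∏_{j ≠ i} (t - z j)/(z i - z j)`. -/
noncomputable def lagC {m : ℕ} (t : ℝ) (z : Fin m → ℝ) (i : Fin m) : ℝ :=
  ∏ j ∈ Finset.univ.erase i, (t - z j) / (z i - z j)

/-- `f` is `n`-convex on `I`: for all `x₀ < x₁ < ⋯ < x_{n+1}` in `I`,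
`(-1)^n f(x₀) ≤ (-1)^n ∑ᵢ cᵢ(x₀; x₁,…,x_{n+1}) f(xᵢ)`. -/
def NConvexOn (n : ℕ) (I : Set ℝ) (f : ℝ → ℝ) : Prop :=
  ∀ x : Fin (n + 2) → ℝ, (∀ i, x i ∈ I) → StrictMono x →
    (-1 : ℝ) ^ n * f (x 0) ≤
      (-1 : ℝ) ^ n * ∑ i : Fin (n + 1), lagC (x 0) (fun j => x j.succ) i * f (x i.succ)

/-- `f` is `n`-concave on `I` iff `-f` is `n`-convex on `I`. -/
def NConcaveOn (n : ℕ) (I : Set ℝ) (f : ℝ → ℝ) : Prop :=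
  NConvexOn n I (fun t => -f t)

open Polynomial Finset in
theorem lagC_eq_eval_basis {m : ℕ} (t : ℝ) (z : Fin m → ℝ) (i : Fin m) :
    lagC t z i = (Lagrange.basis univ z i).eval t := by
  simp only [lagC, Lagrange.basis, Lagrange.basisDivisor, eval_prod, eval_mul, eval_C, eval_sub,
    eval_X]
  exact prod_congr rfl fun j _ => by rw [div_eq_inv_mul]

open Finset in
theorem eval_interpolate_eq_sum_lagC {m : ℕ} (t : ℝ) (z v : Fin m → ℝ) :
    (Lagrange.interpolate univ z v).eval t = ∑ i, lagC t z i * v i := by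
  simp [Lagrange.interpolate_apply, Polynomial.eval_finsetSum, lagC_eq_eval_basis, mul_comm]

theorem natDegree_interpolate_le {ι : Type*} [DecidableEq ι] {s : Finset ι} {z : ι → ℝ}
    (hz : Set.InjOn z s) {n : ℕ} (hs : s.card ≤ n + 1) (v : ι → ℝ) :
    (Lagrange.interpolate s z v).natDegree ≤ n := by
  rcases eq_or_ne (Lagrange.interpolate s z v) 0 with h | h
  · simp [h]
  · exact Nat.lt_succ_iff.1 ((Polynomial.natDegree_lt_iff_degree_lt h).2
      ((Lagrange.degree_interpolate_lt v hz).trans_le (by exact_mod_cast hs)))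

/-- A convex combination of `a ≤ 0` and `b ≥ 0` vanishes. -/
theorem exists_convexCombo_eq_zero {a b : ℝ} (ha : a ≤ 0) (hb : 0 ≤ b) :
    ∃ t : ℝ, 0 ≤ t ∧ t ≤ 1 ∧ t * a + (1 - t) * b = 0 := by
  rcases eq_or_lt_of_le (ha.trans hb) with h | h
  · exact ⟨0, le_rfl, zero_le_one, by linarith⟩
  · have h' : 0 < b - a := by linarith
    refine ⟨b / (b - a), by positivity, (div_le_one h').2 (by linarith), ?_⟩
    field_simp
    ring

/-- At any `n + 2` points, an `n`-concave minorant and an `n`-convex majorant can be separated by a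
polynomial of degree at most `n`. -/
theorem exists_separating_polynomial_of_strictMono {n : ℕ} {I : Set ℝ} {f g : ℝ → ℝ}
    (hf : NConcaveOn n I f) (hg : NConvexOn n I g) (hfg : ∀ x ∈ I, f x ≤ g x)
    {x : Fin (n + 2) → ℝ} (hx : ∀ i, x i ∈ I) (hmono : StrictMono x) :
    ∃ w : Polynomial ℝ, w.natDegree ≤ n ∧
      ∀ i, f (x i) ≤ w.eval (x i) ∧ w.eval (x i) ≤ g (x i) := by
  have h1 := hf x hx hmono
  have h2 := hg x hx hmono
  set c : Fin (n + 1) → ℝ := lagC (x 0) fun j => x j.succ with hc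
  simp only [mul_neg, Finset.sum_neg_distrib] at h1
  obtain ⟨t, ht0, ht1, ht⟩ := exists_convexCombo_eq_zero
    (a := (-1 : ℝ) ^ n * (∑ i, c i * f (x i.succ) - f (x 0)))
    (b := (-1 : ℝ) ^ n * (∑ i, c i * g (x i.succ) - g (x 0)))
    (by linarith) (by linarith)
  let h : ℝ → ℝ := fun y => t * f y + (1 - t) * g y
  have hinj : Function.Injective fun j : Fin (n + 1) => x j.succ :=
    hmono.injective.comp (Fin.succ_injective _)
  let w := Lagrange.interpolate Finset.univ (fun j : Fin (n + 1) => x j.succ) fun j => h (x j.succ)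
  have hw : ∀ i, w.eval (x i) = h (x i) := by
    refine Fin.cases ?_ fun j => ?_
    · have hsum : ∑ i, c i * h (x i.succ)
          = t * ∑ i, c i * f (x i.succ) + (1 - t) * ∑ i, c i * g (x i.succ) := by
        simp only [Finset.mul_sum, ← Finset.sum_add_distrib, h]
        exact Finset.sum_congr rfl fun i _ => by ring
      rw [eval_interpolate_eq_sum_lagC, ← hc, hsum]
      have hne : (-1 : ℝ) ^ n ≠ 0 := by simp
      refine mul_left_cancel₀ hne ?_
      simp only [h]
      linarith
    · exact Lagrange.eval_interpolate_at_node _ hinj.injOn (Finset.mem_univ j)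
  refine ⟨w, natDegree_interpolate_le hinj.injOn (by simp) _, fun i => ?_⟩
  have hi := hfg _ (hx i)
  rw [hw]
  constructor <;> simp only [h] <;> nlinarith

theorem exists_separating_polynomial_of_finite {n : ℕ} {I : Set ℝ} {f g : ℝ → ℝ}
    (hfg : ∀ x ∈ I, f x ≤ g x) (hI : ∀ T : Finset ℝ, ↑T ⊆ I → T.card ≠ n + 2) :
    ∃ w : Polynomial ℝ, w.natDegree ≤ n ∧
      ∀ x ∈ I, f x ≤ w.eval x ∧ w.eval x ≤ g x := by
  have hfin : I.Finite := by
    by_contra hinf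
    obtain ⟨T, hT, hcard⟩ := Set.Infinite.exists_subset_card_eq hinf (n + 2)
    exact hI T hT hcard
  lift I to Finset ℝ using hfin
  have hcard : I.card ≤ n + 1 := by
    by_contra! hlt
    obtain ⟨T, hT, hcard⟩ := Finset.exists_subset_card_eq (show n + 2 ≤ I.card from hlt)
    exact hI T (by exact_mod_cast hT) hcard
  have hinj : Set.InjOn (id : ℝ → ℝ) I := Set.injOn_id _
  refine ⟨Lagrange.interpolate I id f, natDegree_interpolate_le hinj hcard f, fun x hx => ?_⟩
  have hx' : (Lagrange.interpolate I id f).eval x = f x :=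
    Lagrange.eval_interpolate_at_node f hinj hx
  exact ⟨hx'.ge, hx'.trans_le (hfg x hx)⟩

/-- If `f` is `n`-concave, `g` is `n`-convex and `f ≤ g` on the interval `I`, then
some polynomial of degree at most `n` separates `f` from `g` on `I`. -/
theorem stmt_5 (n : ℕ) (I : Set ℝ) (hI : I.OrdConnected) (f g : ℝ → ℝ)
    (hf : NConcaveOn n I f) (hg : NConvexOn n I g)
    (hfg : ∀ x ∈ I, f x ≤ g x) :
    ∃ w : Polynomial ℝ, w.natDegree ≤ n ∧
      ∀ x ∈ I, f x ≤ w.eval x ∧ w.eval x ≤ g x := by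
  by_cases hT : ∀ T : Finset ℝ, ↑T ⊆ I → T.card ≠ n + 2
  · exact exists_separating_polynomial_of_finite hfg hT
  push Not at hT
  obtain ⟨T, hTI, hTcard⟩ := hT
  let z : Fin (n + 1) → ℝ := fun j => T.orderEmbOfFin hTcard j.succ
  have hzT : ∀ j, z j ∈ T := fun j => T.orderEmbOfFin_mem hTcard _
  have hz : Function.Injective z :=
    (T.orderEmbOfFin hTcard).injective.comp (Fin.succ_injective _)
  -- A polynomial of degree at most `n` is encoded by its values at the nodes `z`.
  let ev : ℝ → (Fin (n + 1) → ℝ) →ₗ[ℝ] ℝ := fun y =>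
    Polynomial.leval y ∘ₗ Lagrange.interpolate Finset.univ z
  let F : ℝ → Set (Fin (n + 1) → ℝ) := fun y => ev y ⁻¹' Set.Icc (f y) (g y)
  have hev_node : ∀ v j, ev (z j) v = v j := fun v j =>
    Lagrange.eval_interpolate_at_node v hz.injOn (Finset.mem_univ j)
  have hfinite : ∀ U : Finset ℝ, ↑U ⊆ I → T ⊆ U → (⋂ y ∈ U, F y).Nonempty := by
    intro U hUI hTU
    refine Convex.helly_theorem (𝕜 := ℝ) ?_ (fun y _ => (convex_Icc _ _).linear_preimage (ev y)) ?_
    · simpa [← hTcard] using Finset.card_le_card hTU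
    · intro S hSU hS
      have hS' : S.card = n + 2 := by simpa using hS
      obtain ⟨w, hdeg, hw⟩ := exists_separating_polynomial_of_strictMono hf hg hfg
        (fun i => hUI (hSU (S.orderEmbOfFin_mem hS' i))) (S.orderEmbOfFin hS').strictMono
      have hdeg' : w.degree < (Finset.univ : Finset (Fin (n + 1))).card := by
        rw [Finset.card_fin]
        exact (Polynomial.natDegree_le_iff_degree_le.1 hdeg).trans_lt
          (by exact_mod_cast n.lt_succ_self)
      refine ⟨fun j => w.eval (z j), Set.mem_iInter₂.2 fun y hy => ?_⟩
      obtain ⟨i, rfl⟩ : y ∈ Set.range (S.orderEmbOfFin hS') := by simpa using hy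
      change (Lagrange.interpolate _ z _).eval _ ∈ Set.Icc _ _
      rw [← Lagrange.eq_interpolate hz.injOn hdeg']
      exact hw i
  have hcompact : IsCompact (Set.univ.pi fun j => Set.Icc (f (z j)) (g (z j))) :=
    isCompact_univ_pi fun j => isCompact_Icc
  obtain ⟨v, -, hv⟩ := hcompact.inter_iInter_nonempty (fun y : I => F y)
    (fun y => isClosed_Icc.preimage (ev y).continuous_of_finiteDimensional) fun u => by
      classical
      obtain ⟨v, hv⟩ := hfinite (u.image Subtype.val ∪ T)
        (by
          intro y hy
          rcases Finset.mem_union.1 (Finset.mem_coe.1 hy) with h | h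
          · obtain ⟨y, -, rfl⟩ := Finset.mem_image.1 h
            exact y.2
          · exact hTI h)
        Finset.subset_union_right
      rw [Set.mem_iInter₂] at hv
      refine ⟨v, fun j _ => ?_, Set.mem_iInter₂.2 fun y hy =>
        hv y (Finset.mem_union_left _ (Finset.mem_image_of_mem _ hy))⟩
      have := hv (z j) (Finset.mem_union_right _ (hzT j))
      simpa only [F, Set.mem_preimage, hev_node] using this
  exact ⟨Lagrange.interpolate Finset.univ z v, natDegree_interpolate_le hz.injOn (by simp) v,
    fun y hy => Set.mem_iInter.1 hv ⟨y, hy⟩⟩
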